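/- Let G be a connected, locally connected, locally compact, σ-compact Hausdorff space and f : G → H a proper continuous surjection onto a space H of the same kind, such that preimages of points are connected and preimages of connected open sets are connected. Then f induces a homeomorphism between the end spaces of G and H. -/

import Mathlib

/-- The space of ends of a topological space `X`: an end assigns to every compact set
`K ⊆ X` a connected component of its complement, compatibly with inclusions. -/
def EndsOf (X : Type*) [TopologicalSpace X] : Type _ :=
  {e : ∀ K : Set X, IsCompact K → Set X //
    (∀ (K : Set X) (hK : IsCompact K), ∃ x ∈ Kᶜ, e K hK = connectedComponentIn Kᶜ x) ∧
    ∀ (K K' : Set X) (hK : IsCompact K) (hK' : IsCompact K'),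
      K ⊆ K' → e K' hK' ⊆ e K hK}

/-- The natural (profinite-like) topology on the space of ends: the topology induced by
the evaluation maps `e ↦ e K`, with discrete target. -/
def endsTopology (X : Type*) [TopologicalSpace X] : TopologicalSpace (EndsOf X) :=
  TopologicalSpace.induced
    (fun (e : EndsOf X) (K : {K : Set X // IsCompact K}) => e.1 K.1 K.2)
    (@Pi.topologicalSpace _ _ (fun _K => (⊥ : TopologicalSpace (Set X))))

namespace EndsOf

variable {X Y : Type*} [TopologicalSpace X] [TopologicalSpace Y]

lemma eq_connectedComponentIn (e : EndsOf X) {K : Set X} (hK : IsCompact K) {x : X}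
    (hx : x ∈ e.1 K hK) : e.1 K hK = connectedComponentIn Kᶜ x := by
  obtain ⟨y, -, h⟩ := e.2.1 K hK
  rw [h] at hx ⊢
  exact connectedComponentIn_eq hx

lemma nonempty (e : EndsOf X) {K : Set X} (hK : IsCompact K) : (e.1 K hK).Nonempty := by
  obtain ⟨y, hy, h⟩ := e.2.1 K hK
  exact ⟨y, h ▸ mem_connectedComponentIn hy⟩

lemma subset_compl (e : EndsOf X) {K : Set X} (hK : IsCompact K) : e.1 K hK ⊆ Kᶜ := by
  obtain ⟨y, -, h⟩ := e.2.1 K hK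
  exact h ▸ connectedComponentIn_subset _ _

lemma isConnected (e : EndsOf X) {K : Set X} (hK : IsCompact K) : IsConnected (e.1 K hK) := by
  obtain ⟨y, hy, h⟩ := e.2.1 K hK
  exact h ▸ isConnected_connectedComponentIn_iff.2 hy

lemma isOpen [T2Space X] [LocallyConnectedSpace X] (e : EndsOf X) {K : Set X}
    (hK : IsCompact K) : IsOpen (e.1 K hK) := by
  obtain ⟨y, -, h⟩ := e.2.1 K hK
  exact h ▸ hK.isClosed.isOpen_compl.connectedComponentIn

lemma ext_apply {e e' : EndsOf X} (h : ∀ K hK, e.1 K hK = e'.1 K hK) : e = e' :=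
  Subtype.ext (funext fun K => funext fun hK => h K hK)

/-- A map between end spaces is continuous when each component of the image depends on a single
component of the argument. -/
lemma continuous_of_eval {φ : EndsOf X → EndsOf Y}
    (h : ∀ (K : Set Y) (hK : IsCompact K), ∃ (L : Set X) (hL : IsCompact L) (g : Set X → Set Y),
      ∀ e, (φ e).1 K hK = g (e.1 L hL)) :
    @Continuous _ _ (endsTopology X) (endsTopology Y) φ := by
  let : TopologicalSpace (EndsOf X) := endsTopology X
  let : TopologicalSpace (Set X) := ⊥
  let : TopologicalSpace (Set Y) := ⊥
  have : DiscreteTopology (Set X) := ⟨rfl⟩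
  refine continuous_induced_rng.2 (continuous_pi fun K => ?_)
  obtain ⟨L, hL, g, hg⟩ := h K.1 K.2
  have hcoe : Continuous fun (e : EndsOf X) (K : {K : Set X // IsCompact K}) => e.1 K.1 K.2 :=
    continuous_induced_dom
  have hev : Continuous fun e : EndsOf X => e.1 L hL :=
    (continuous_apply (⟨L, hL⟩ : {K : Set X // IsCompact K})).comp hcoe
  exact ((continuous_of_discreteTopology (f := g)).comp hev).congr fun e => (hg e).symm

end EndsOf

/-- The union of the connected components of `F` that meet `S`. -/
def componentsMeeting {X : Type*} [TopologicalSpace X] (F S : Set X) : Set X :=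
  ⋃ x ∈ S, connectedComponentIn F x

lemma componentsMeeting_eq {X : Type*} [TopologicalSpace X] {F S : Set X}
    (hS : IsPreconnected S) (hSF : S ⊆ F) {x : X} (hx : x ∈ S) :
    componentsMeeting F S = connectedComponentIn F x := by
  refine Set.Subset.antisymm (Set.iUnion₂_subset fun y hy => ?_)
    (Set.subset_biUnion_of_mem (u := fun x => connectedComponentIn F x) hx)
  exact (connectedComponentIn_eq (hS.subset_connectedComponentIn hx hSF hy)).ge

section Collapse

variable {G H : Type*} [TopologicalSpace G] [TopologicalSpace H]
  [LocallyConnectedSpace H] {f : G → H}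

lemma connectedComponentIn_preimage_of_isOpen (hf : Continuous f)
    (hconn : ∀ U : Set H, IsOpen U → IsConnected U → IsConnected (f ⁻¹' U))
    {U : Set H} (hU : IsOpen U) {x : G} (hx : f x ∈ U) :
    connectedComponentIn (f ⁻¹' U) x = f ⁻¹' connectedComponentIn U (f x) := by
  apply Set.Subset.antisymm
  · rw [← Set.image_subset_iff]
    exact (isPreconnected_connectedComponentIn.image f hf.continuousOn).subset_connectedComponentIn
      (Set.mem_image_of_mem f (mem_connectedComponentIn hx))
      (Set.image_subset_iff.2 (connectedComponentIn_subset _ _))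
  · exact (hconn _ hU.connectedComponentIn
      (isConnected_connectedComponentIn_iff.2 hx)).isPreconnected.subset_connectedComponentIn
      (mem_connectedComponentIn hx) (Set.preimage_mono (connectedComponentIn_subset _ _))

variable [T2Space H]

lemma EndsOf.apply_preimage_eq (hf : IsProperMap f)
    (hconn : ∀ U : Set H, IsOpen U → IsConnected U → IsConnected (f ⁻¹' U))
    (e : EndsOf G) {K : Set H} (hK : IsCompact K) {x : G}
    (hx : x ∈ e.1 (f ⁻¹' K) (hf.isCompact_preimage hK)) :
    e.1 (f ⁻¹' K) (hf.isCompact_preimage hK) = f ⁻¹' connectedComponentIn Kᶜ (f x) := by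
  rw [e.eq_connectedComponentIn _ hx, ← Set.preimage_compl]
  exact connectedComponentIn_preimage_of_isOpen hf.continuous hconn hK.isClosed.isOpen_compl
    (e.subset_compl _ hx)

/-- The map on ends induced by a proper surjection that pulls connected open sets back to
connected sets. -/
def EndsOf.map (hf : IsProperMap f) (hsurj : Function.Surjective f)
    (hconn : ∀ U : Set H, IsOpen U → IsConnected U → IsConnected (f ⁻¹' U))
    (e : EndsOf G) : EndsOf H :=
  ⟨fun K hK => f '' e.1 (f ⁻¹' K) (hf.isCompact_preimage hK), fun K hK => by
    obtain ⟨x, hx⟩ := e.nonempty (hf.isCompact_preimage hK)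
    refine ⟨f x, e.subset_compl _ hx, ?_⟩
    beta_reduce
    rw [e.apply_preimage_eq hf hconn hK hx, Set.image_preimage_eq _ hsurj],
  fun _ _ _ _ h => Set.image_mono (e.2.2 _ _ _ _ (Set.preimage_mono h))⟩

lemma EndsOf.componentsMeeting_preimage_eq (hf : Continuous f)
    (hconn : ∀ U : Set H, IsOpen U → IsConnected U → IsConnected (f ⁻¹' U))
    (e : EndsOf H) {L : Set G} (hL : IsCompact L) {x : G}
    (hx : f x ∈ e.1 (f '' L) (hL.image hf)) :
    componentsMeeting Lᶜ (f ⁻¹' e.1 (f '' L) (hL.image hf)) = connectedComponentIn Lᶜ x :=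
  componentsMeeting_eq (hconn _ (e.isOpen _) (e.isConnected _)).isPreconnected
    (fun _ hy hyL => e.subset_compl _ hy (Set.mem_image_of_mem f hyL)) hx

/-- The map on ends in the direction opposite to a surjection that pulls connected open sets back
to connected sets: the component of `Lᶜ` is the one containing the preimage of the component of
`(f '' L)ᶜ`. -/
def EndsOf.comap (hf : Continuous f) (hsurj : Function.Surjective f)
    (hconn : ∀ U : Set H, IsOpen U → IsConnected U → IsConnected (f ⁻¹' U))
    (e : EndsOf H) : EndsOf G :=
  ⟨fun L hL => componentsMeeting Lᶜ (f ⁻¹' e.1 (f '' L) (hL.image hf)), fun L hL => by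
    obtain ⟨x, hx⟩ := (e.nonempty (hL.image hf)).preimage hsurj
    exact ⟨x, fun hxL => e.subset_compl _ hx (Set.mem_image_of_mem f hxL),
      e.componentsMeeting_preimage_eq hf hconn hL hx⟩,
  fun L L' hL hL' h => by
    obtain ⟨x, hx⟩ := (e.nonempty (hL'.image hf)).preimage hsurj
    have hx' : f x ∈ e.1 (f '' L) (hL.image hf) := e.2.2 _ _ _ _ (Set.image_mono h) hx
    beta_reduce
    rw [e.componentsMeeting_preimage_eq hf hconn hL' hx,
      e.componentsMeeting_preimage_eq hf hconn hL hx']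
    exact connectedComponentIn_mono x (Set.compl_subset_compl.2 h)⟩

lemma EndsOf.comap_map (hf : IsProperMap f) (hsurj : Function.Surjective f)
    (hconn : ∀ U : Set H, IsOpen U → IsConnected U → IsConnected (f ⁻¹' U)) (e : EndsOf G) :
    (e.map hf hsurj hconn).comap hf.continuous hsurj hconn = e := by
  refine EndsOf.ext_apply fun L hL => ?_
  have hK := hL.image hf.continuous
  obtain ⟨x, hx⟩ := e.nonempty (hf.isCompact_preimage hK)
  have hxL : x ∈ e.1 L hL := e.2.2 _ _ _ _ (Set.subset_preimage_image f L) hx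
  rw [e.eq_connectedComponentIn hL hxL]
  exact (e.map hf hsurj hconn).componentsMeeting_preimage_eq hf.continuous hconn hL
    (Set.mem_image_of_mem f hx)

lemma EndsOf.map_comap (hf : IsProperMap f) (hsurj : Function.Surjective f)
    (hconn : ∀ U : Set H, IsOpen U → IsConnected U → IsConnected (f ⁻¹' U)) (e : EndsOf H) :
    (e.comap hf.continuous hsurj hconn).map hf hsurj hconn = e := by
  refine EndsOf.ext_apply fun K hK => ?_
  have hL := hf.isCompact_preimage hK
  obtain ⟨x, hx⟩ := (e.nonempty (hL.image hf.continuous)).preimage hsurj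
  have hxK : f x ∈ e.1 K hK :=
    e.2.2 _ _ _ _ (Set.image_preimage_eq K hsurj).ge hx
  change f '' componentsMeeting (f ⁻¹' K)ᶜ _ = _
  rw [e.componentsMeeting_preimage_eq hf.continuous hconn hL hx, ← Set.preimage_compl,
    connectedComponentIn_preimage_of_isOpen hf.continuous hconn hK.isClosed.isOpen_compl
      (e.subset_compl _ hxK), Set.image_preimage_eq _ hsurj, ← e.eq_connectedComponentIn hK hxK]

end Collapse

/-- Abstract version of Proposition `p.codingends`: a proper continuous surjection
between connected, locally connected, locally compact, σ-compact Hausdorff spaces with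
connected fibers and connected preimages of connected open sets induces a homeomorphism
between the end spaces. -/
theorem stmt8 {G H : Type*} [TopologicalSpace G] [TopologicalSpace H]
    [T2Space G] [ConnectedSpace G] [LocallyConnectedSpace G]
    [LocallyCompactSpace G] [SigmaCompactSpace G]
    [T2Space H] [ConnectedSpace H] [LocallyConnectedSpace H]
    [LocallyCompactSpace H] [SigmaCompactSpace H]
    (f : G → H) (hf : IsProperMap f) (hsurj : Function.Surjective f)
    (hfib : ∀ y : H, IsConnected (f ⁻¹' {y}))
    (hconn : ∀ U : Set H, IsOpen U → IsConnected U → IsConnected (f ⁻¹' U)) :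
    letI := endsTopology G
    letI := endsTopology H
    ∃ φ : EndsOf G ≃ₜ EndsOf H,
      ∀ (e : EndsOf G) (K : Set H) (hK : IsCompact K),
        f '' (e.1 (f ⁻¹' K) (hf.isCompact_preimage hK)) ⊆ (φ e).1 K hK := by
  let := endsTopology G
  let := endsTopology H
  exact ⟨{
    toFun := fun e => e.map hf hsurj hconn
    invFun := fun e => e.comap hf.continuous hsurj hconn
    left_inv := EndsOf.comap_map hf hsurj hconn
    right_inv := EndsOf.map_comap hf hsurj hconn
    continuous_toFun := EndsOf.continuous_of_eval fun K hK =>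
      ⟨f ⁻¹' K, hf.isCompact_preimage hK, fun S => f '' S, fun _ => rfl⟩
    continuous_invFun := EndsOf.continuous_of_eval fun L hL =>
      ⟨f '' L, hL.image hf.continuous, fun S => componentsMeeting Lᶜ (f ⁻¹' S), fun _ => rfl⟩ },
    fun _ _ _ => subset_rfl⟩
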